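/- Let T' := T ∪ (T + (1.6, 0)) denote the union of the tunnel T with its translate by the vector (1.6, 0). For every point p in the closed triangle with vertices (0,0), (ε',0), (0,ε') there exist points q, r ∈ ℝ² with dist(p, q) = dist(q, r) = 1, with both closed segments [p, q] and [q, r] contained in T', and with r in the closed triangle with vertices (1.6,0), (1.6+ε',0), (1.6,ε'). Symmetrically, for every point p in the closed triangle with vertices (0,0.6), (ε',0.6), (0,0.6−ε') there exist such q, r with r in the closed triangle with vertices (1.6,0.6), (1.6+ε',0.6), (1.6,0.6−ε'). -/

import Mathlib

noncomputable section

open Set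

/-- The Euclidean plane. -/
abbrev E2 := EuclideanSpace ℝ (Fin 2)

/-- The point of `ℝ²` with coordinates `x` and `y`. -/
def pt (x y : ℝ) : E2 := (WithLp.equiv 2 (Fin 2 → ℝ)).symm ![x, y]

/-- Piecewise-linear interpolation through a list of breakpoints `(xᵢ, yᵢ)`
(with strictly increasing `xᵢ`), evaluated at `x`. -/
def pl : List (ℝ × ℝ) → ℝ → ℝ
  | [], _ => 0
  | [(_, y₀)], _ => y₀
  | (x₀, y₀) :: (x₁, y₁) :: rest, x =>
      if x ≤ x₁ then y₀ + (y₁ - y₀) * (x - x₀) / (x₁ - x₀)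
      else pl ((x₁, y₁) :: rest) x

/-- The quadrant area `Q1(c, r)`: points of the closed disc of radius `r` around `c`
that lie (weakly) to the upper right of `c`. -/
def Q1 (c : E2) (r : ℝ) : Set E2 := {p | dist p c ≤ r ∧ c 0 ≤ p 0 ∧ c 1 ≤ p 1}

/-- The quadrant area `Q2(c, r)` (upper left). -/
def Q2 (c : E2) (r : ℝ) : Set E2 := {p | dist p c ≤ r ∧ p 0 ≤ c 0 ∧ c 1 ≤ p 1}

/-- The quadrant area `Q3(c, r)` (lower left). -/
def Q3 (c : E2) (r : ℝ) : Set E2 := {p | dist p c ≤ r ∧ p 0 ≤ c 0 ∧ p 1 ≤ c 1}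

/-- The quadrant area `Q4(c, r)` (lower right). -/
def Q4 (c : E2) (r : ℝ) : Set E2 := {p | dist p c ≤ r ∧ c 0 ≤ p 0 ∧ p 1 ≤ c 1}

/-- The breakpoints of the lower boundary polyline of the tunnel (here `ε' = ε/2`). -/
def tunnelLowerPts (ε : ℝ) : List (ℝ × ℝ) :=
  [(0, 0), (ε / 2, 0), (0.4, 0.3 - ε / 2), (0.8 - ε / 2, 0), (0.8, 0),
   (0.8 + ε / 2, 0), (1.2, 0.3 - ε / 2), (1.6 - ε / 2, 0), (1.6, 0)]

/-- The breakpoints of the upper boundary polyline of the tunnel (here `ε' = ε/2`). -/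
def tunnelUpperPts (ε : ℝ) : List (ℝ × ℝ) :=
  [(0, 0.6), (ε / 2, 0.6), (0.4, 0.3 + ε / 2), (0.8 - ε / 2, 0.6), (0.8, 0.6),
   (0.8 + ε / 2, 0.6), (1.2, 0.3 + ε / 2), (1.6 - ε / 2, 0.6), (1.6, 0.6)]

/-- Obstacle OT1: the triangle with vertices `(0, ε')`, `(0.4 − ε', 0.3)`, `(0, 0.6 − ε')`. -/
def OT1 (ε : ℝ) : Set E2 :=
  convexHull ℝ {pt 0 (ε / 2), pt (0.4 - ε / 2) 0.3, pt 0 (0.6 - ε / 2)}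

/-- Obstacle OT2: the rhombus with vertices `(0.4 + ε', 0.3)`, `(0.8, ε')`,
`(1.2 − ε', 0.3)`, `(0.8, 0.6 − ε')`. -/
def OT2 (ε : ℝ) : Set E2 :=
  convexHull ℝ {pt (0.4 + ε / 2) 0.3, pt 0.8 (ε / 2), pt (1.2 - ε / 2) 0.3, pt 0.8 (0.6 - ε / 2)}

/-- Obstacle OT3: the triangle with vertices `(1.6, ε')`, `(1.2 + ε', 0.3)`, `(1.6, 0.6 − ε')`. -/
def OT3 (ε : ℝ) : Set E2 :=
  convexHull ℝ {pt 1.6 (ε / 2), pt (1.2 + ε / 2) 0.3, pt 1.6 (0.6 - ε / 2)}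

/-- The tunnel `T`: the closed region between the lower and upper sawtooth polylines
over `0 ≤ x ≤ 1.6`, with the interiors of the three obstacles OT1, OT2, OT3 removed. -/
def tunnel (ε : ℝ) : Set E2 :=
  {p | 0 ≤ p 0 ∧ p 0 ≤ 1.6 ∧
      pl (tunnelLowerPts ε) (p 0) ≤ p 1 ∧ p 1 ≤ pl (tunnelUpperPts ε) (p 0)} \
    (interior (OT1 ε) ∪ interior (OT2 ε) ∪ interior (OT3 ε))

@[simp] lemma pt_apply_zero (x y : ℝ) : pt x y 0 = x := rfl

@[simp] lemma pt_apply_one (x y : ℝ) : pt x y 1 = y := rfl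

lemma eq_pt (p : E2) : p = pt (p 0) (p 1) := by
  ext i; fin_cases i <;> rfl

lemma dist_pt_eq_one {x₁ y₁ x₂ y₂ : ℝ} (h : (x₁ - x₂) ^ 2 + (y₁ - y₂) ^ 2 = 1) :
    dist (pt x₁ y₁) (pt x₂ y₂) = 1 := by
  simp [EuclideanSpace.dist_eq, Fin.sum_univ_two, Real.dist_eq, h]

/-- A set whose points satisfy `a * x + b * y ≤ c` has no interior point with
`c ≤ a * x + b * y`, unless `a = b = 0`. -/
lemma notMem_interior_convexHull {V : Set E2} {p : E2} (a b c : ℝ) (hab : a ^ 2 + b ^ 2 ≠ 0)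
    (hV : ∀ v ∈ V, a * v 0 + b * v 1 ≤ c) (hp : c ≤ a * p 0 + b * p 1) :
    p ∉ interior (convexHull ℝ V) := by
  let f : E2 →L[ℝ] ℝ := a • EuclideanSpace.proj 0 + b • EuclideanSpace.proj 1
  have hf : ∀ v, f v = a * v 0 + b * v 1 := fun v => by simp [f]
  have hne : f ≠ 0 := fun h => hab (by
    have := hf (pt a b)
    simp only [h, pt_apply_zero, pt_apply_one, zero_apply] at this
    linarith)
  have hsub : convexHull ℝ V ⊆ f ⁻¹' Iic c :=
    convexHull_min (fun v hv => by simpa [hf] using hV v hv)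
      ((convex_Iic c).linear_preimage f.toLinearMap)
  intro h
  have h1 : f p ∈ interior (Iic c) :=
    interior_maximal (image_subset_iff.2 (interior_subset.trans hsub))
      (f.isOpenMap_of_ne_zero hne _ isOpen_interior) (mem_image_of_mem f h)
  rw [interior_Iic, mem_Iio, hf] at h1
  linarith

lemma pl_tunnelUpperPts (ε x : ℝ) :
    pl (tunnelUpperPts ε) x = 0.6 - pl (tunnelLowerPts ε) x := by
  simp only [tunnelUpperPts, tunnelLowerPts, pl]
  split_ifs <;> ring

lemma add_mul_div_le {a b m n y : ℝ} (hn : 0 < n) (h : b * m ≤ (y - a) * n) :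
    a + b * m / n ≤ y := by
  have := (div_le_iff₀ hn).2 h
  linarith

/-- The corridor of the tunnel joining the lower left to the upper middle opening. -/
def risingCorridor (ε : ℝ) : Set (ℝ × ℝ) :=
  {z | 0 ≤ z.1 ∧ z.1 ≤ 0.8 + ε / 2 ∧ 0 ≤ z.2 ∧ z.2 ≤ 0.6 ∧ 0.75 * (z.1 - ε / 2) ≤ z.2 ∧
    (0.4 - ε / 2) * (z.2 - ε / 2) ≤ (0.3 - ε / 2) * z.1}

/-- The corridor joining the upper middle to the lower right opening of the tunnel, prolonged
into the next tunnel. -/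
def fallingCorridor (ε : ℝ) : Set (ℝ × ℝ) :=
  {z | 0.8 ≤ z.1 ∧ z.1 ≤ 1.6 + ε / 2 ∧ 0 ≤ z.2 ∧ z.2 ≤ 0.6 ∧ 1.2 ≤ z.2 + 0.75 * z.1 ∧
    z.2 + 0.75 * z.1 ≤ 1.2 + 0.75 * (ε / 2)}

lemma convex_risingCorridor (ε : ℝ) : Convex ℝ (risingCorridor ε) := by
  rintro ⟨x, y⟩ ⟨h1, h2, h3, h4, h5, h6⟩ ⟨x', y'⟩ ⟨k1, k2, k3, k4, k5, k6⟩ a b ha hb hab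
  obtain rfl : b = 1 - a := by linarith
  simp only at *
  refine ⟨?_, ?_, ?_, ?_, ?_, ?_⟩ <;>
    simp only [Prod.fst_add, Prod.snd_add, Prod.smul_fst, Prod.smul_snd, smul_eq_mul]
  · nlinarith [mul_le_mul_of_nonneg_left h1 ha, mul_le_mul_of_nonneg_left k1 hb]
  · nlinarith [mul_le_mul_of_nonneg_left h2 ha, mul_le_mul_of_nonneg_left k2 hb]
  · nlinarith [mul_le_mul_of_nonneg_left h3 ha, mul_le_mul_of_nonneg_left k3 hb]
  · nlinarith [mul_le_mul_of_nonneg_left h4 ha, mul_le_mul_of_nonneg_left k4 hb]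
  · nlinarith [mul_le_mul_of_nonneg_left h5 ha, mul_le_mul_of_nonneg_left k5 hb]
  · nlinarith [mul_le_mul_of_nonneg_left h6 ha, mul_le_mul_of_nonneg_left k6 hb]

lemma convex_fallingCorridor (ε : ℝ) : Convex ℝ (fallingCorridor ε) := by
  rintro ⟨x, y⟩ ⟨h1, h2, h3, h4, h5, h6⟩ ⟨x', y'⟩ ⟨k1, k2, k3, k4, k5, k6⟩ a b ha hb hab
  obtain rfl : b = 1 - a := by linarith
  simp only at *
  refine ⟨?_, ?_, ?_, ?_, ?_, ?_⟩ <;>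
    simp only [Prod.fst_add, Prod.snd_add, Prod.smul_fst, Prod.smul_snd, smul_eq_mul]
  · nlinarith [mul_le_mul_of_nonneg_left h1 ha, mul_le_mul_of_nonneg_left k1 hb]
  · nlinarith [mul_le_mul_of_nonneg_left h2 ha, mul_le_mul_of_nonneg_left k2 hb]
  · nlinarith [mul_le_mul_of_nonneg_left h3 ha, mul_le_mul_of_nonneg_left k3 hb]
  · nlinarith [mul_le_mul_of_nonneg_left h4 ha, mul_le_mul_of_nonneg_left k4 hb]
  · nlinarith [mul_le_mul_of_nonneg_left h5 ha, mul_le_mul_of_nonneg_left k5 hb]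
  · nlinarith [mul_le_mul_of_nonneg_left h6 ha, mul_le_mul_of_nonneg_left k6 hb]

lemma pl_tunnelLowerPts_le_of_risingCorridor {ε x y : ℝ} (hε0 : 0 < ε) (hε : ε ≤ 1 / 100)
    (h : (x, y) ∈ risingCorridor ε) :
    pl (tunnelLowerPts ε) x ≤ y ∧ pl (tunnelLowerPts ε) x ≤ 0.6 - y := by
  obtain ⟨h1, h2, h3, h4, h5, h6⟩ := h
  simp only at h1 h2 h3 h4 h5 h6
  constructor <;> simp only [tunnelLowerPts, pl] <;>
    split_ifs <;> apply add_mul_div_le <;> nlinarith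

lemma pt_mem_tunnel_of_risingCorridor {ε x y : ℝ} (hε0 : 0 < ε) (hε : ε ≤ 1 / 100)
    (h : (x, y) ∈ risingCorridor ε) : pt x y ∈ tunnel ε ∧ pt x (0.6 - y) ∈ tunnel ε := by
  obtain ⟨hl, hu⟩ := pl_tunnelLowerPts_le_of_risingCorridor hε0 hε h
  obtain ⟨h1, h2, h3, h4, h5, h6⟩ := h
  simp only at h1 h2 h3 h4 h5 h6
  have h7 : x ≤ 0.4 + ε / 2 ∨ (0.3 - ε / 2) * (x - 0.4 - ε / 2) ≤ (0.4 - ε / 2) * (y - 0.3) := by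
    rcases le_total x (0.4 + ε / 2) with hx | hx
    · exact .inl hx
    · right; nlinarith
  refine ⟨⟨⟨?_, ?_, ?_, ?_⟩, ?_⟩, ⟨⟨?_, ?_, ?_, ?_⟩, ?_⟩⟩ <;>
    simp only [pt_apply_zero, pt_apply_one, pl_tunnelUpperPts, mem_union, not_or] <;>
    try linarith
  · refine ⟨⟨?_, ?_⟩, ?_⟩
    · refine notMem_interior_convexHull (0.3 - ε / 2) (-(0.4 - ε / 2)) (-((0.4 - ε / 2) * (ε / 2)))
        ?_ ?_ ?_
      · nlinarith
      · rintro v (rfl | rfl | rfl) <;> simp only [pt_apply_zero, pt_apply_one] <;> nlinarith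
      · simp only [pt_apply_zero, pt_apply_one]; nlinarith
    · rcases h7 with h7 | h7
      · refine notMem_interior_convexHull (-1) 0 (-(0.4 + ε / 2)) (by norm_num) ?_ ?_
        · rintro v (rfl | rfl | rfl | rfl) <;> simp only [pt_apply_zero, pt_apply_one] <;> nlinarith
        · simp only [pt_apply_zero, pt_apply_one]; nlinarith
      · refine notMem_interior_convexHull (-(0.3 - ε / 2)) (0.4 - ε / 2)
          ((0.4 - ε / 2) * 0.3 - (0.3 - ε / 2) * (0.4 + ε / 2)) ?_ ?_ ?_
        · nlinarith
        · rintro v (rfl | rfl | rfl | rfl) <;> simp only [pt_apply_zero, pt_apply_one] <;> nlinarith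
        · simp only [pt_apply_zero, pt_apply_one]; nlinarith
    · refine notMem_interior_convexHull (-1) 0 (-(1.2 + ε / 2)) (by norm_num) ?_ ?_
      · rintro v (rfl | rfl | rfl) <;> simp only [pt_apply_zero, pt_apply_one] <;> nlinarith
      · simp only [pt_apply_zero, pt_apply_one]; nlinarith
  · refine ⟨⟨?_, ?_⟩, ?_⟩
    · refine notMem_interior_convexHull (0.3 - ε / 2) (0.4 - ε / 2)
        ((0.4 - ε / 2) * (0.6 - ε / 2)) ?_ ?_ ?_
      · nlinarith
      · rintro v (rfl | rfl | rfl) <;> simp only [pt_apply_zero, pt_apply_one] <;> nlinarith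
      · simp only [pt_apply_zero, pt_apply_one]; nlinarith
    · rcases h7 with h7 | h7
      · refine notMem_interior_convexHull (-1) 0 (-(0.4 + ε / 2)) (by norm_num) ?_ ?_
        · rintro v (rfl | rfl | rfl | rfl) <;> simp only [pt_apply_zero, pt_apply_one] <;> nlinarith
        · simp only [pt_apply_zero, pt_apply_one]; nlinarith
      · refine notMem_interior_convexHull (-(0.3 - ε / 2)) (-(0.4 - ε / 2))
          (-(0.4 - ε / 2) * 0.3 - (0.3 - ε / 2) * (0.4 + ε / 2)) ?_ ?_ ?_
        · nlinarith
        · rintro v (rfl | rfl | rfl | rfl) <;> simp only [pt_apply_zero, pt_apply_one] <;> nlinarith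
        · simp only [pt_apply_zero, pt_apply_one]; nlinarith
    · refine notMem_interior_convexHull (-1) 0 (-(1.2 + ε / 2)) (by norm_num) ?_ ?_
      · rintro v (rfl | rfl | rfl) <;> simp only [pt_apply_zero, pt_apply_one] <;> nlinarith
      · simp only [pt_apply_zero, pt_apply_one]; nlinarith

lemma pl_tunnelLowerPts_le_of_fallingCorridor {ε x y : ℝ} (hε0 : 0 < ε) (hε : ε ≤ 1 / 100)
    (h : (x, y) ∈ fallingCorridor ε) (hx : x ≤ 1.6) :
    pl (tunnelLowerPts ε) x ≤ y ∧ pl (tunnelLowerPts ε) x ≤ 0.6 - y := by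
  obtain ⟨h1, h2, h3, h4, h5, h6⟩ := h
  simp only at h1 h2 h3 h4 h5 h6
  have n1 : ¬ x ≤ ε / 2 := by linarith
  have n2 : ¬ x ≤ 0.4 := by linarith
  have n3 : ¬ x ≤ 0.8 - ε / 2 := by linarith
  constructor <;> simp only [tunnelLowerPts, pl, if_neg n1, if_neg n2, if_neg n3] <;>
    split_ifs <;> apply add_mul_div_le <;> nlinarith

lemma pt_mem_tunnel_of_fallingCorridor {ε x y : ℝ} (hε0 : 0 < ε) (hε : ε ≤ 1 / 100)
    (h : (x, y) ∈ fallingCorridor ε) (hx : x ≤ 1.6) :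
    pt x y ∈ tunnel ε ∧ pt x (0.6 - y) ∈ tunnel ε := by
  obtain ⟨hl, hu⟩ := pl_tunnelLowerPts_le_of_fallingCorridor hε0 hε h hx
  obtain ⟨h1, h2, h3, h4, h5, h6⟩ := h
  simp only at h1 h2 h3 h4 h5 h6
  refine ⟨⟨⟨?_, ?_, ?_, ?_⟩, ?_⟩, ⟨⟨?_, ?_, ?_, ?_⟩, ?_⟩⟩ <;>
    simp only [pt_apply_zero, pt_apply_one, pl_tunnelUpperPts, mem_union, not_or] <;>
    try linarith
  · refine ⟨⟨?_, ?_⟩, ?_⟩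
    · refine notMem_interior_convexHull 1 0 (0.4 - ε / 2) (by norm_num) ?_ ?_
      · rintro v (rfl | rfl | rfl) <;> simp only [pt_apply_zero, pt_apply_one] <;> nlinarith
      · simp only [pt_apply_zero, pt_apply_one]; nlinarith
    · refine notMem_interior_convexHull 0.75 1 1.2 (by norm_num) ?_ ?_
      · rintro v (rfl | rfl | rfl | rfl) <;> simp only [pt_apply_zero, pt_apply_one] <;> nlinarith
      · simp only [pt_apply_zero, pt_apply_one]; nlinarith
    · refine notMem_interior_convexHull (-0.75) (-1) (-(1.2 + 0.75 * (ε / 2))) (by norm_num) ?_ ?_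
      · rintro v (rfl | rfl | rfl) <;> simp only [pt_apply_zero, pt_apply_one] <;> nlinarith
      · simp only [pt_apply_zero, pt_apply_one]; nlinarith
  · refine ⟨⟨?_, ?_⟩, ?_⟩
    · refine notMem_interior_convexHull 1 0 (0.4 - ε / 2) (by norm_num) ?_ ?_
      · rintro v (rfl | rfl | rfl) <;> simp only [pt_apply_zero, pt_apply_one] <;> nlinarith
      · simp only [pt_apply_zero, pt_apply_one]; nlinarith
    · refine notMem_interior_convexHull 0.75 (-1) 0.6 (by norm_num) ?_ ?_
      · rintro v (rfl | rfl | rfl | rfl) <;> simp only [pt_apply_zero, pt_apply_one] <;> nlinarith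
      · simp only [pt_apply_zero, pt_apply_one]; nlinarith
    · refine notMem_interior_convexHull (-0.75) 1 (-(0.6 + 0.75 * (ε / 2))) (by norm_num) ?_ ?_
      · rintro v (rfl | rfl | rfl) <;> simp only [pt_apply_zero, pt_apply_one] <;> nlinarith
      · simp only [pt_apply_zero, pt_apply_one]; nlinarith

lemma pt_mem_union_of_fallingCorridor {ε x y : ℝ} (hε0 : 0 < ε) (hε : ε ≤ 1 / 100)
    (h : (x, y) ∈ fallingCorridor ε) :
    pt x y ∈ tunnel ε ∪ ((· + pt 1.6 0) '' tunnel ε) ∧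
      pt x (0.6 - y) ∈ tunnel ε ∪ ((· + pt 1.6 0) '' tunnel ε) := by
  rcases le_total x 1.6 with hx | hx
  · exact (pt_mem_tunnel_of_fallingCorridor hε0 hε h hx).imp .inl .inl
  · have hshift : ∀ y, pt (x - 1.6) y + pt 1.6 0 = pt x y := fun y => by
      ext i; fin_cases i <;> simp [pt]
    obtain ⟨h1, h2, h3, h4, h5, h6⟩ := h
    simp only at h1 h2 h3 h4 h5 h6
    have h' : (x - 1.6, y) ∈ risingCorridor ε := by
      refine ⟨?_, ?_, ?_, ?_, ?_, ?_⟩ <;> simp only <;> nlinarith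
    exact (pt_mem_tunnel_of_risingCorridor hε0 hε h').imp
      (fun h => .inr ⟨_, h, hshift _⟩) (fun h => .inr ⟨_, h, hshift _⟩)

/-- If a convex set `C` of coordinate pairs is mapped into `S` by `(x, y) ↦ (x, b + k * y)`, then
so is every segment with endpoints in `C`. -/
lemma segment_pt_subset {C : Set (ℝ × ℝ)} (hC : Convex ℝ C) {S : Set E2} {b k : ℝ}
    (hS : ∀ x y, (x, y) ∈ C → pt x (b + k * y) ∈ S) {x₁ y₁ x₂ y₂ : ℝ}
    (h₁ : (x₁, y₁) ∈ C) (h₂ : (x₂, y₂) ∈ C) :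
    segment ℝ (pt x₁ (b + k * y₁)) (pt x₂ (b + k * y₂)) ⊆ S := by
  rintro _ ⟨u, v, hu, hv, huv, rfl⟩
  convert hS _ _ (hC h₁ h₂ hu hv huv) using 1
  obtain rfl : v = 1 - u := by linarith
  ext i
  fin_cases i <;> simp [pt]
  ring

/-- The two-edge unit chain through both corridors, up to a reflection `y ↦ b + k * y`. -/
lemma exists_unit_chain {ε b k : ℝ} (hε : ε ≤ 1 / 100) (hk : k ^ 2 = 1)
    {S : Set E2} (hR : ∀ x y, (x, y) ∈ risingCorridor ε → pt x (b + k * y) ∈ S)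
    (hF : ∀ x y, (x, y) ∈ fallingCorridor ε → pt x (b + k * y) ∈ S)
    {x y : ℝ} (hx : 0 ≤ x) (hy : 0 ≤ y) (hxy : x + y ≤ ε / 2) :
    ∃ (q : E2) (t : ℝ), 0 ≤ t ∧ t ≤ ε / 2 ∧ dist (pt x (b + k * y)) q = 1 ∧
      dist q (pt (1.6 + t) b) = 1 ∧ segment ℝ (pt x (b + k * y)) q ⊆ S ∧
      segment ℝ q (pt (1.6 + t) b) ⊆ S := by
  set c := √(1 - (0.6 - y) ^ 2) with hc
  have hc2 : c ^ 2 = 1 - (0.6 - y) ^ 2 := Real.sq_sqrt (by nlinarith)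
  have hc1 : 0.8 ≤ c := Real.le_sqrt_of_sq_le (by nlinarith)
  have hc3 : c ≤ 0.8 + 0.75 * y := by
    refine Real.sqrt_le_iff.2 ⟨by linarith, by nlinarith⟩
  have hq : (x + c, (0.6 : ℝ)) ∈ risingCorridor ε := by
    refine ⟨?_, ?_, ?_, ?_, ?_, ?_⟩ <;> simp only <;> nlinarith
  have hp : (x, y) ∈ risingCorridor ε := by
    refine ⟨?_, ?_, ?_, ?_, ?_, ?_⟩ <;> simp only <;> nlinarith
  have hq' : (x + c, (0.6 : ℝ)) ∈ fallingCorridor ε := by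
    refine ⟨?_, ?_, ?_, ?_, ?_, ?_⟩ <;> simp only <;> linarith
  have hr : (1.6 + (x + c - 0.8), (0 : ℝ)) ∈ fallingCorridor ε := by
    refine ⟨?_, ?_, ?_, ?_, ?_, ?_⟩ <;> simp only <;> linarith
  refine ⟨pt (x + c) (b + k * 0.6), x + c - 0.8, by linarith, by linarith, ?_, ?_, ?_, ?_⟩
  · exact dist_pt_eq_one (by linear_combination hc2 + (y - 0.6) ^ 2 * hk)
  · exact dist_pt_eq_one (by linear_combination 0.36 * hk)
  · exact segment_pt_subset (convex_risingCorridor ε) hR hp hq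
  · simpa using segment_pt_subset (convex_fallingCorridor ε) hF hq' hr

lemma exists_coords_of_mem_triangle {e b k : ℝ} (hk : k ^ 2 = 1) (he : 0 ≤ e) {p : E2}
    (hp : p ∈ convexHull ℝ {pt 0 b, pt e b, pt 0 (b + k * e)}) :
    ∃ x y, 0 ≤ x ∧ 0 ≤ y ∧ x + y ≤ e ∧ p = pt x (b + k * y) := by
  have hconv : Convex ℝ {p : E2 | 0 ≤ p 0 ∧ 0 ≤ k * (p 1 - b) ∧ p 0 + k * (p 1 - b) ≤ e} := by
    rintro u ⟨h1, h2, h3⟩ v ⟨k1, k2, k3⟩ s t hs ht hst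
    obtain rfl : t = 1 - s := by linarith
    refine ⟨?_, ?_, ?_⟩ <;> simp only [PiLp.add_apply, PiLp.smul_apply, smul_eq_mul]
    · nlinarith [mul_le_mul_of_nonneg_left h1 hs, mul_le_mul_of_nonneg_left k1 ht]
    · nlinarith [mul_le_mul_of_nonneg_left h2 hs, mul_le_mul_of_nonneg_left k2 ht]
    · nlinarith [mul_le_mul_of_nonneg_left h3 hs, mul_le_mul_of_nonneg_left k3 ht]
  have hkk : k * (k * e) = e := by linear_combination e * hk
  obtain ⟨h1, h2, h3⟩ := convexHull_min (t := {p : E2 | 0 ≤ p 0 ∧ 0 ≤ k * (p 1 - b) ∧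
      p 0 + k * (p 1 - b) ≤ e}) (by
    rintro v (rfl | rfl | rfl) <;> simp [he, hkk]) hconv hp
  refine ⟨p 0, k * (p 1 - b), h1, h2, h3, ?_⟩
  have : b + k * (k * (p 1 - b)) = p 1 := by linear_combination (p 1 - b) * hk
  rw [this]
  exact eq_pt p

lemma pt_add_mem_convexHull {e t a b : ℝ} {v : E2} (ht0 : 0 ≤ t) (ht : t ≤ e) :
    pt (a + t) b ∈ convexHull ℝ {pt a b, pt (a + e) b, v} := by
  have hsub : segment ℝ (pt a b) (pt (a + e) b) ⊆ convexHull ℝ {pt a b, pt (a + e) b, v} :=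
    segment_subset_convexHull (by simp) (by simp)
  rcases ht0.eq_or_lt with rfl | ht0
  · exact subset_convexHull _ _ (by simp)
  · have he : 0 < e := ht0.trans_le ht
    refine hsub ⟨1 - t / e, t / e, ?_, by positivity, by ring, ?_⟩
    · rw [sub_nonneg, div_le_one he]; exact ht
    · ext i
      fin_cases i <;> simp [pt] <;> field_simp <;> ring

/-- existence part of the tunnel lemma.  Let `T' = T ∪ (T + (1.6, 0))`.
From every point of the lower (resp. upper) start triangle one can realize a
two-edge unit chain whose segments lie in `T'` and which ends in the lower
(resp. upper) end triangle at the right opening of `T`. -/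
theorem tunnel_existence (ε : ℝ) (hε0 : 0 < ε) (hε : ε ≤ 1 / 100) :
    (∀ p ∈ convexHull ℝ {pt 0 0, pt (ε / 2) 0, pt 0 (ε / 2)},
      ∃ q r : E2, dist p q = 1 ∧ dist q r = 1 ∧
        segment ℝ p q ⊆ tunnel ε ∪ ((· + pt 1.6 0) '' tunnel ε) ∧
        segment ℝ q r ⊆ tunnel ε ∪ ((· + pt 1.6 0) '' tunnel ε) ∧
        r ∈ convexHull ℝ {pt 1.6 0, pt (1.6 + ε / 2) 0, pt 1.6 (ε / 2)}) ∧
    (∀ p ∈ convexHull ℝ {pt 0 0.6, pt (ε / 2) 0.6, pt 0 (0.6 - ε / 2)},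
      ∃ q r : E2, dist p q = 1 ∧ dist q r = 1 ∧
        segment ℝ p q ⊆ tunnel ε ∪ ((· + pt 1.6 0) '' tunnel ε) ∧
        segment ℝ q r ⊆ tunnel ε ∪ ((· + pt 1.6 0) '' tunnel ε) ∧
        r ∈ convexHull ℝ {pt 1.6 0.6, pt (1.6 + ε / 2) 0.6, pt 1.6 (0.6 - ε / 2)}) := by
  have hR := fun x y => pt_mem_tunnel_of_risingCorridor (x := x) (y := y) hε0 hε
  have hF := fun x y => pt_mem_union_of_fallingCorridor (x := x) (y := y) hε0 hε
  constructor
  · intro p hp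
    obtain ⟨x, y, hx, hy, hxy, rfl⟩ := exists_coords_of_mem_triangle (e := ε / 2) (b := 0) (k := 1)
      (by norm_num) (by linarith) (by simpa using hp)
    obtain ⟨q, t, ht0, ht, h1, h2, h3, h4⟩ := exists_unit_chain (b := 0) (k := 1)
      (S := tunnel ε ∪ ((· + pt 1.6 0) '' tunnel ε)) hε (by norm_num)
      (fun x y h => .inl (by simpa using (hR x y h).1))
      (fun x y h => by simpa only [zero_add, one_mul] using (hF x y h).1) hx hy hxy
    exact ⟨q, _, h1, h2, h3, h4, pt_add_mem_convexHull ht0 ht⟩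
  · intro p hp
    obtain ⟨x, y, hx, hy, hxy, rfl⟩ := exists_coords_of_mem_triangle (e := ε / 2) (b := 0.6)
      (k := -1) (by norm_num) (by linarith) (by simpa only [neg_one_mul, ← sub_eq_add_neg] using hp)
    obtain ⟨q, t, ht0, ht, h1, h2, h3, h4⟩ := exists_unit_chain (b := 0.6) (k := -1)
      (S := tunnel ε ∪ ((· + pt 1.6 0) '' tunnel ε)) hε (by norm_num)
      (fun x y h => .inl (by simpa only [neg_one_mul, ← sub_eq_add_neg] using (hR x y h).2))
      (fun x y h => by simpa only [neg_one_mul, ← sub_eq_add_neg] using (hF x y h).2) hx hy hxy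
    exact ⟨q, _, h1, h2, h3, h4, pt_add_mem_convexHull ht0 ht⟩
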